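/- arXiv:1007.1260 — 3 statements merged into one kernel-verified Lean document; each statement's English description precedes it below -/
import Mathlib

section
/- Let φ, δ, γ ∈ (0,1), let n be a positive integer, let a_1, ..., a_n ∈ (0,1] and W = Σ_{i=1}^n a_i. Let I_1, ..., I_k be the (φ,δ,γ)-partition of (0,1] for this n, and set c₃ = δ⁴/(2(1+δ)). Then the total size of the items lying in intervals containing few items is small: Σ over all indices j with C(I_j, S) < c₃·W of Σ_{a_i ∈ I_j} a_i is at most (δ³/2)·W + γ/n, where S denotes the multiset {a_1, ..., a_n}. -/
open scoped Classical

/-- The sequence of right endpoints of the `(φ,δ,γ)`-partition of `(0,1]`: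
`π₀ = 1`, `π₁ = φ`, and `πᵢ = πᵢ₋₁·(1−δ)` for `i ≥ 2`. -/
noncomputable def partitionPoint (φ δ : ℝ) (j : ℕ) : ℝ :=
  if j = 0 then 1 else φ * (1 - δ) ^ (j - 1)

/-- Membership of `x` in the `j`-th interval of the `(φ,δ,γ)`-partition with `k` intervals:
`I₁ = [π₁, π₀]`, `I_j = (π_j, π_{j-1}]` for `2 ≤ j ≤ k−1`, and `I_k = (0, π_{k-1}]`. -/
noncomputable def memInterval (φ δ : ℝ) (k j : ℕ) (x : ℝ) : Prop :=
  if j = 1 then partitionPoint φ δ 1 ≤ x ∧ x ≤ partitionPoint φ δ 0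
  else if j = k then 0 < x ∧ x ≤ partitionPoint φ δ (k - 1)
  else partitionPoint φ δ j < x ∧ x ≤ partitionPoint φ δ (j - 1)

theorem partitionPoint_nonneg {φ δ : ℝ} (hφ : 0 ≤ φ) (hδ : δ ≤ 1) (j : ℕ) :
    0 ≤ partitionPoint φ δ j := by
  have : 0 ≤ 1 - δ := by linarith
  unfold partitionPoint
  split_ifs <;> positivity

theorem memInterval.le_partitionPoint {φ δ x : ℝ} {k j : ℕ} (h : memInterval φ δ k j x) :
    x ≤ partitionPoint φ δ (j - 1) := by
  unfold memInterval at h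
  split_ifs at h with h₁ h₂
  · subst h₁
    exact h.2
  · subst h₂
    exact h.2
  · exact h.2

theorem sum_range_partitionPoint_le {φ δ : ℝ} (hφ : φ ∈ Set.Icc (0 : ℝ) 1)
    (hδ : δ ∈ Set.Ioo (0 : ℝ) 1) (k : ℕ) :
    ∑ j ∈ Finset.range k, partitionPoint φ δ j ≤ (1 + δ) / δ := by
  obtain ⟨hδ₀, hδ₁⟩ := hδ
  have hgeom : ∑ j ∈ Finset.range k, (1 - δ) ^ j ≤ 1 / δ := by
    have h := mul_neg_geom_sum (1 - δ) k
    have hpow : 0 ≤ (1 - δ) ^ k := pow_nonneg (by linarith) k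
    rw [le_div_iff₀ hδ₀]
    linarith
  calc ∑ j ∈ Finset.range k, partitionPoint φ δ j
      ≤ ∑ j ∈ Finset.range (k + 1), partitionPoint φ δ j :=
        Finset.sum_le_sum_of_subset_of_nonneg (Finset.range_mono k.le_succ)
          fun j _ _ => partitionPoint_nonneg hφ.1 hδ₁.le j
    _ = φ * ∑ j ∈ Finset.range k, (1 - δ) ^ j + 1 := by
        rw [Finset.sum_range_succ', Finset.mul_sum]
        simp [partitionPoint]
    _ ≤ 1 * (1 / δ) + 1 := by
        gcongr
        exact hφ.2
    _ = (1 + δ) / δ := by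
        field_simp

theorem sum_memInterval_le_card_mul (φ δ : ℝ) (k j : ℕ) (s : Finset ℕ) (a : ℕ → ℝ) :
    ∑ i ∈ s.filter (fun i => memInterval φ δ k j (a i)), a i ≤
      ((s.filter (fun i => memInterval φ δ k j (a i))).card : ℝ) *
        partitionPoint φ δ (j - 1) := by
  rw [← nsmul_eq_mul]
  exact Finset.sum_le_card_nsmul _ _ _ fun i hi => (Finset.mem_filter.1 hi).2.le_partitionPoint

theorem small_intervals_contribution (φ δ γ : ℝ)
    (hφ : φ ∈ Set.Ioo (0 : ℝ) 1) (hδ : δ ∈ Set.Ioo (0 : ℝ) 1) (hγ : γ ∈ Set.Ioo (0 : ℝ) 1)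
    (n : ℕ) (hn : 0 < n) (a : ℕ → ℝ)
    (ha : ∀ i ∈ Finset.Icc 1 n, a i ∈ Set.Ioc (0 : ℝ) 1)
    (k : ℕ) (hk2 : 2 ≤ k)
    (hkle : partitionPoint φ δ (k - 1) ≤ γ / (n : ℝ) ^ 2)
    (hkmin : ∀ j : ℕ, j < k - 1 → γ / (n : ℝ) ^ 2 < partitionPoint φ δ j) :
    ∑ j ∈ (Finset.Icc 1 k).filter (fun j =>
        (((Finset.Icc 1 n).filter (fun i => memInterval φ δ k j (a i))).card : ℝ) <
          δ ^ 4 / (2 * (1 + δ)) * ∑ i ∈ Finset.Icc 1 n, a i),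
      ∑ i ∈ (Finset.Icc 1 n).filter (fun i => memInterval φ δ k j (a i)), a i
      ≤ δ ^ 3 / 2 * (∑ i ∈ Finset.Icc 1 n, a i) + γ / n := by
  obtain ⟨hδ₀, hδ₁⟩ := hδ
  set W := ∑ i ∈ Finset.Icc 1 n, a i
  set c := δ ^ 4 / (2 * (1 + δ)) with hc
  have hW : 0 ≤ W := Finset.sum_nonneg fun i hi => (ha i hi).1.le
  have hcW : 0 ≤ c * W := by positivity
  have hγn : 0 ≤ γ / n := div_nonneg hγ.1.le n.cast_nonneg
  have hp := partitionPoint_nonneg hφ.1.le hδ₁.le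
  calc _ ≤ ∑ j ∈ (Finset.Icc 1 k).filter (fun j =>
        (((Finset.Icc 1 n).filter (fun i => memInterval φ δ k j (a i))).card : ℝ) < c * W),
          c * W * partitionPoint φ δ (j - 1) :=
        Finset.sum_le_sum fun j hj => (sum_memInterval_le_card_mul φ δ k j _ a).trans
          (mul_le_mul_of_nonneg_right (Finset.mem_filter.1 hj).2.le (hp (j - 1)))
    _ ≤ ∑ j ∈ Finset.Icc 1 k, c * W * partitionPoint φ δ (j - 1) :=
        Finset.sum_le_sum_of_subset_of_nonneg (Finset.filter_subset _ _)
          fun j _ _ => mul_nonneg hcW (hp (j - 1))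
    _ = c * W * ∑ j ∈ Finset.range k, partitionPoint φ δ j := by
        rw [← Finset.mul_sum, Finset.range_eq_Ico, Finset.sum_Ico_eq_sum_range,
          ← Finset.Ico_add_one_right_eq_Icc, Finset.sum_Ico_eq_sum_range]
        simp
    _ ≤ c * W * ((1 + δ) / δ) := by
        gcongr
        exact sum_range_partitionPoint_le ⟨hφ.1.le, hφ.2.le⟩ ⟨hδ₀, hδ₁⟩ k
    _ = δ ^ 3 / 2 * W := by
        rw [hc]
        field_simp
    _ ≤ δ ^ 3 / 2 * W + γ / n := le_add_of_nonneg_right hγn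
end

section
/- Let A = (a_1, ..., a_n) be a list of n reals, let m ≥ 2 be an integer with m ≤ n, let μ, α ∈ (0,1), let h = ⌊n/m⌋ and γ = μ/(4m). Let u be a positive integer with 2m·e^{−γ²u/3} ≤ α and γ·u ≥ 3, and assume n ≥ 3(m+1)²/μ. Let J_1, ..., J_u be independent random indices, each uniformly distributed on {1, ..., n}, and set X_t = a_{J_t}. For i = 1, ..., m let y_i be the ⌈(i/m)·u⌉-th smallest value among X_1, ..., X_u (equivalently, the least value y among the samples such that #{t ≤ u : X_t ≤ y} ≥ ⌈(i/m)·u⌉). Then the probability that there exists i ∈ {1, ..., m} with [minRank(y_i, A), maxRank(y_i, A)] ∩ [i·h − μ·h, i·h + μ·h] = ∅ is at most α. -/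
open MeasureTheory ProbabilityTheory

/-- `minRank y a n = 1 + #{j ∈ [1,n] : a j < y}`. -/
noncomputable def minRank (n : ℕ) (a : ℕ → ℝ) (y : ℝ) : ℕ :=
  1 + ((Finset.Icc 1 n).filter (fun j => a j < y)).card

/-- `maxRank y a n = #{j ∈ [1,n] : a j ≤ y}`. -/
noncomputable def maxRank (n : ℕ) (a : ℕ → ℝ) (y : ℝ) : ℕ :=
  ((Finset.Icc 1 n).filter (fun j => a j ≤ y)).card

/-- Given sampled indices `s : Fin u → ℕ` into the list `a`, the `i`-th empirical quantile:
the least sampled value `v` such that at least `⌈(i/m)·u⌉` of the samples are `≤ v`. -/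
noncomputable def empQuantile (u : ℕ) (a : ℕ → ℝ) (m i : ℕ) (s : Fin u → ℕ) : ℝ :=
  sInf {v : ℝ | (∃ t : Fin u, a (s t) = v) ∧
    ⌈(i : ℝ) / (m : ℝ) * (u : ℝ)⌉₊ ≤ (Finset.univ.filter (fun t : Fin u => a (s t) ≤ v)).card}

open Finset in
/-- The empirical quantile is a sample, at least a fraction `i / m` of the samples is at most it,
and less than a fraction `i / m` of the samples is below it. -/
theorem empQuantile_spec {u m i : ℕ} (a : ℕ → ℝ) (s : Fin u → ℕ) (hu : 0 < u) (hi : 0 < i)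
    (him : i ≤ m) :
    (∃ t, a (s t) = empQuantile u a m i s) ∧
      (i : ℝ) / m * u ≤ #{t | a (s t) ≤ empQuantile u a m i s} ∧
      (#{t | a (s t) < empQuantile u a m i s} : ℝ) < (i : ℝ) / m * u := by
  let Q : Set ℝ := {v : ℝ | (∃ t : Fin u, a (s t) = v) ∧
    ⌈(i : ℝ) / (m : ℝ) * (u : ℝ)⌉₊ ≤ #{t : Fin u | a (s t) ≤ v}}
  have hy : empQuantile u a m i s = sInf Q := rfl
  have hm : 0 < (m : ℝ) := by exact_mod_cast hi.trans_le him
  have hfin : Q.Finite :=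
    (Set.finite_range fun t => a (s t)).subset fun v hv => hv.1
  have hne : Q.Nonempty := by
    obtain ⟨t, -, ht⟩ := Finset.exists_max_image univ (fun t => a (s t)) ⟨⟨0, hu⟩, mem_univ _⟩
    refine ⟨a (s t), ⟨t, rfl⟩, ?_⟩
    rw [Finset.filter_true_of_mem fun t' _ => ht t' (mem_univ _), Nat.ceil_le]
    simp only [card_univ, Fintype.card_fin]
    refine mul_le_of_le_one_left (by positivity) ((div_le_one hm).2 (by exact_mod_cast him))
  have hmem : sInf Q ∈ Q := hne.csInf_mem hfin
  rw [hy]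
  refine ⟨hmem.1, Nat.ceil_le.1 hmem.2, ?_⟩
  by_contra! hle
  have hpos : 0 < #{t | a (s t) < sInf Q} := by
    have : 0 < (i : ℝ) / m * u := by positivity
    exact_mod_cast this.trans_le hle
  obtain ⟨t, ht, htmax⟩ :=
    Finset.exists_max_image _ (fun t => a (s t)) (Finset.card_pos.1 hpos)
  refine (Finset.mem_filter.1 ht).2.not_ge (csInf_le hfin.bddBelow ⟨⟨t, rfl⟩, ?_⟩)
  refine (Nat.ceil_le.2 hle).trans (Finset.card_le_card fun t' ht' => ?_)
  exact Finset.mem_filter.2 ⟨mem_univ _, htmax t' ht'⟩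

section Sampling

open Finset

variable {Ω : Type*} [MeasurableSpace Ω] {μm : Measure Ω} [IsProbabilityMeasure μm] {n u : ℕ}
  {J : Fin u → Ω → ℕ}

/-- The probability that a uniform index satisfies `P`. -/
theorem measureReal_uniform_index {K : Ω → ℕ} (hK : Measurable K)
    (hrange : ∀ ω, K ω ∈ Icc 1 n) (hunif : ∀ i ∈ Icc 1 n, μm {ω | K ω = i} = (n : ENNReal)⁻¹)
    (P : ℕ → Prop) [DecidablePred P] :
    μm.real {ω | P (K ω)} = #{j ∈ Icc 1 n | P j} / n := by
  have hpre : {ω | P (K ω)} = K ⁻¹' ({j ∈ Icc 1 n | P j} : Finset ℕ) := by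
    ext ω
    have := hrange ω
    simp_all
  rw [hpre, ← sum_measureReal_preimage_singleton _ fun y _ => hK (measurableSet_singleton y),
    Finset.sum_congr rfl (g := fun _ => (n : ℝ)⁻¹), Finset.sum_const, nsmul_eq_mul, div_eq_mul_inv]
  intro j hj
  have := hunif j (Finset.mem_filter.1 hj).1
  simp [measureReal_def, Set.preimage, this]

/-- Hoeffding's upper tail bound for the number of uniform samples satisfying `P`. -/
theorem measureReal_le_sample_count_le (hu : 0 < u) (hn : 0 < n) (hJmeas : ∀ t, Measurable (J t))
    (hJrange : ∀ t ω, J t ω ∈ Icc 1 n)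
    (hJunif : ∀ t, ∀ i ∈ Icc 1 n, μm {ω | J t ω = i} = (n : ENNReal)⁻¹)
    (hJindep : iIndepFun J μm) (P : ℕ → Prop) [DecidablePred P] {r ε : ℝ} (hε : 0 ≤ ε)
    (hP : (#{j ∈ Icc 1 n | P j} : ℝ) ≤ (r - ε) * n) :
    μm.real {ω | r * u ≤ #{t | P (J t ω)}} ≤ Real.exp (-2 * ε ^ 2 * u) := by
  set p : ℝ := #{j ∈ Icc 1 n | P j} / n with hp
  have hpr : p ≤ r - ε := (div_le_iff₀ (by exact_mod_cast hn)).2 hP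
  let g : ℕ → ℝ := fun j => if P j then 1 else 0
  have hmean : ∀ t, μm[fun ω => g (J t ω)] = p := fun t => by
    have hset : MeasurableSet {ω | P (J t ω)} :=
      hJmeas t (MeasurableSet.of_discrete (s := {j | P j}))
    rw [hp, ← measureReal_uniform_index (hJmeas t) (hJrange t) (hJunif t) P,
      ← integral_indicator_one hset]
    exact integral_congr_ae (.of_forall fun ω => by
      by_cases hω : P (J t ω) <;> simp [g, hω])
  have hsub : ∀ t ∈ (univ : Finset (Fin u)),
      HasSubgaussianMGF (fun ω => g (J t ω) - p) ((‖(1 : ℝ) - 0‖₊ / 2) ^ 2) μm := fun t _ => by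
    rw [← hmean t]
    refine hasSubgaussianMGF_of_mem_Icc ((measurable_of_countable g).comp (hJmeas t)).aemeasurable
      (.of_forall fun ω => ?_)
    by_cases h : P (J t ω) <;> simp [g, h]
  have hindep : iIndepFun (fun t ω => g (J t ω) - p) μm :=
    hJindep.comp (fun _ j => g j - p) fun _ => measurable_of_countable _
  refine le_trans (measureReal_mono fun ω hω => ?_)
    ((HasSubgaussianMGF.measure_sum_ge_le_of_iIndepFun hindep hsub
      (ε := ε * u) (by positivity)).trans_eq ?_)
  · simp only [Set.mem_ofPred_eq, g, Finset.sum_sub_distrib, Finset.sum_boole, Finset.sum_const,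
      card_univ, Fintype.card_fin, nsmul_eq_mul] at hω ⊢
    nlinarith [mul_le_mul_of_nonneg_right hpr (Nat.cast_nonneg (α := ℝ) u)]
  · have hu' : (u : ℝ) ≠ 0 := by positivity
    congr 1
    simp
    field_simp

/-- Hoeffding's lower tail bound for the number of uniform samples satisfying `P`. -/
theorem measureReal_sample_count_le_le (hu : 0 < u) (hn : 0 < n) (hJmeas : ∀ t, Measurable (J t))
    (hJrange : ∀ t ω, J t ω ∈ Icc 1 n)
    (hJunif : ∀ t, ∀ i ∈ Icc 1 n, μm {ω | J t ω = i} = (n : ENNReal)⁻¹)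
    (hJindep : iIndepFun J μm) (P : ℕ → Prop) [DecidablePred P] {r ε : ℝ} (hε : 0 ≤ ε)
    (hP : (r + ε) * n ≤ (#{j ∈ Icc 1 n | P j} : ℝ)) :
    μm.real {ω | (#{t | P (J t ω)} : ℝ) ≤ r * u} ≤ Real.exp (-2 * ε ^ 2 * u) := by
  have hcompl {ι : Type} (s : Finset ι) (R : ι → Prop) [DecidablePred R] :
      (#{j ∈ s | R j} : ℝ) + #{j ∈ s | ¬ R j} = #s := by
    exact_mod_cast Finset.card_filter_add_card_filter_not R
  refine le_trans (measureReal_mono fun ω hω => ?_)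
    (measureReal_le_sample_count_le hu hn hJmeas hJrange hJunif hJindep (fun j => ¬ P j)
      (r := 1 - r) hε ?_)
  · have := hcompl univ fun t => P (J t ω)
    simp only [card_univ, Fintype.card_fin, Set.mem_ofPred_eq] at this hω ⊢
    linarith
  · have := hcompl (Icc 1 n) P
    simp only [Nat.card_Icc, add_tsub_cancel_right] at this
    linarith

/-- The rank interval of an empirical quantile is unlikely to lie below `(i / m - ε) * n`. -/
theorem measureReal_maxRank_empQuantile_lt_le (hu : 0 < u) (hn : 0 < n)
    (hJmeas : ∀ t, Measurable (J t)) (hJrange : ∀ t ω, J t ω ∈ Icc 1 n)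
    (hJunif : ∀ t, ∀ i ∈ Icc 1 n, μm {ω | J t ω = i} = (n : ENNReal)⁻¹)
    (hJindep : iIndepFun J μm) (a : ℕ → ℝ) {m i : ℕ} (hi : 0 < i) (him : i ≤ m)
    {ε L : ℝ} (hε : 0 ≤ ε) (hL : L ≤ ((i : ℝ) / m - ε) * n) :
    μm.real {ω | (maxRank n a (empQuantile u a m i fun t => J t ω) : ℝ) < L} ≤
      Real.exp (-2 * ε ^ 2 * u) := by
  by_cases hne : ({j ∈ Icc 1 n | (maxRank n a (a j) : ℝ) < L} : Finset ℕ).Nonempty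
  · obtain ⟨k, hk, hkmax⟩ := Finset.exists_max_image _ a hne
    refine le_trans (measureReal_mono fun ω hω => ?_)
      (measureReal_le_sample_count_le hu hn hJmeas hJrange hJunif hJindep (fun j => a j ≤ a k)
        hε ((Finset.mem_filter.1 hk).2.le.trans hL))
    obtain ⟨⟨t, ht⟩, hcount, -⟩ := empQuantile_spec a (fun t => J t ω) hu hi him
    refine hcount.trans (Nat.cast_le.2 (Finset.card_le_card fun t' ht' => ?_))
    have hle := hkmax (J t ω) (Finset.mem_filter.2 ⟨hJrange t ω, by rw [ht]; exact hω⟩)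
    rw [ht] at hle
    exact Finset.mem_filter.2 ⟨mem_univ _, (Finset.mem_filter.1 ht').2.trans hle⟩
  · rw [Set.eq_empty_of_forall_notMem (s := {ω | _}) fun ω hω => hne ?_]
    · simpa using (Real.exp_pos _).le
    · obtain ⟨⟨t, ht⟩, -⟩ := empQuantile_spec a (fun t => J t ω) hu hi him
      exact ⟨J t ω, Finset.mem_filter.2 ⟨hJrange t ω, by rw [ht]; exact hω⟩⟩

/-- The rank interval of an empirical quantile is unlikely to lie above `(i / m + ε) * n + 1`. -/
theorem measureReal_lt_minRank_empQuantile_le (hu : 0 < u) (hn : 0 < n)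
    (hJmeas : ∀ t, Measurable (J t)) (hJrange : ∀ t ω, J t ω ∈ Icc 1 n)
    (hJunif : ∀ t, ∀ i ∈ Icc 1 n, μm {ω | J t ω = i} = (n : ENNReal)⁻¹)
    (hJindep : iIndepFun J μm) (a : ℕ → ℝ) {m i : ℕ} (hi : 0 < i) (him : i ≤ m)
    {ε R : ℝ} (hε : 0 ≤ ε) (hR : ((i : ℝ) / m + ε) * n + 1 ≤ R) :
    μm.real {ω | R < (minRank n a (empQuantile u a m i fun t => J t ω) : ℝ)} ≤
      Real.exp (-2 * ε ^ 2 * u) := by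
  by_cases hne : ({j ∈ Icc 1 n | R < (minRank n a (a j) : ℝ)} : Finset ℕ).Nonempty
  · obtain ⟨k, hk, hkmin⟩ := Finset.exists_min_image _ a hne
    have hcard : ((i : ℝ) / m + ε) * n ≤ #{j ∈ Icc 1 n | a j < a k} := by
      have h := (Finset.mem_filter.1 hk).2
      simp only [minRank, Nat.cast_add, Nat.cast_one] at h
      linarith
    refine le_trans (measureReal_mono fun ω hω => ?_)
      (measureReal_sample_count_le_le hu hn hJmeas hJrange hJunif hJindep (fun j => a j < a k)
        hε hcard)
    obtain ⟨⟨t, ht⟩, -, hcount⟩ := empQuantile_spec a (fun t => J t ω) hu hi him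
    refine le_trans (Nat.cast_le.2 (Finset.card_le_card fun t' ht' => ?_)) hcount.le
    have hle := hkmin (J t ω) (Finset.mem_filter.2 ⟨hJrange t ω, by rw [ht]; exact hω⟩)
    rw [ht] at hle
    exact Finset.mem_filter.2 ⟨mem_univ _, (Finset.mem_filter.1 ht').2.trans_le hle⟩
  · rw [Set.eq_empty_of_forall_notMem (s := {ω | _}) fun ω hω => hne ?_]
    · simpa using (Real.exp_pos _).le
    · obtain ⟨⟨t, ht⟩, -⟩ := empQuantile_spec a (fun t => J t ω) hu hi him
      exact ⟨J t ω, Finset.mem_filter.2 ⟨hJrange t ω, by rw [ht]; exact hω⟩⟩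

end Sampling

theorem minRank_le_maxRank {n j : ℕ} (a : ℕ → ℝ) (hj : j ∈ Finset.Icc 1 n) :
    minRank n a (a j) ≤ maxRank n a (a j) := by
  rw [minRank, maxRank, add_comm, Nat.add_one_le_iff]
  refine Finset.card_lt_card (Finset.ssubset_iff_of_subset ?_ |>.2 ⟨j, ?_, ?_⟩)
  · exact Finset.monotone_filter_right _ fun _ _ h => le_of_lt h
  · simpa using hj
  · simp

theorem select_crucial_items
    {Ω : Type*} [MeasurableSpace Ω] (μm : Measure Ω) [IsProbabilityMeasure μm]
    (n m u : ℕ) (a : ℕ → ℝ) (μ α : ℝ)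
    (hm : 2 ≤ m) (hmn : m ≤ n)
    (hμ : μ ∈ Set.Ioo (0 : ℝ) 1) (hα : α ∈ Set.Ioo (0 : ℝ) 1)
    (hu : 0 < u)
    (huα : 2 * m * Real.exp (-(μ / (4 * m)) ^ 2 * u / 3) ≤ α)
    (huγ : 3 ≤ μ / (4 * m) * u)
    (hn : 3 * ((m : ℝ) + 1) ^ 2 / μ ≤ (n : ℝ))
    (J : Fin u → Ω → ℕ) (hJmeas : ∀ t, Measurable (J t))
    (hJrange : ∀ t ω, J t ω ∈ Finset.Icc 1 n)
    (hJunif : ∀ t, ∀ i ∈ Finset.Icc 1 n, μm {ω | J t ω = i} = (n : ENNReal)⁻¹)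
    (hJindep : iIndepFun J μm) :
    μm {ω | ∃ i ∈ Finset.Icc 1 m,
        Set.Icc ((minRank n a (empQuantile u a m i (fun t => J t ω)) : ℝ))
            ((maxRank n a (empQuantile u a m i (fun t => J t ω)) : ℝ)) ∩
          Set.Icc ((i : ℝ) * ((n / m : ℕ) : ℝ) - μ * ((n / m : ℕ) : ℝ))
            ((i : ℝ) * ((n / m : ℕ) : ℝ) + μ * ((n / m : ℕ) : ℝ)) = ∅} ≤
      ENNReal.ofReal α := by
  obtain ⟨hμ0, hμ1⟩ := hμ
  have hn0 : 0 < n := by omega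
  have hm0 : (0 : ℝ) < m := by positivity
  have hm1 : (1 : ℝ) ≤ m := by exact_mod_cast (by omega : 1 ≤ m)
  set h : ℝ := ((n / m : ℕ) : ℝ) with hh
  set γ : ℝ := μ / (4 * m) with hγ
  have hγ0 : 0 ≤ γ := by positivity
  have hγm : γ * (4 * m) = μ := by rw [hγ]; field_simp
  have hn' : 3 * ((m : ℝ) + 1) ^ 2 ≤ μ * n := by
    rw [div_le_iff₀ hμ0] at hn
    linarith
  have hupper : h * m ≤ n := by
    rw [hh]
    exact_mod_cast Nat.div_mul_le_self n m
  have hlower : (n : ℝ) ≤ h * m + (m - 1) := by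
    have h1 : n + 1 ≤ n / m * m + m := by
      have := Nat.div_add_mod' n m
      have := Nat.mod_lt n (by omega : 0 < m)
      omega
    have h2 : (n : ℝ) + 1 ≤ h * m + m := by
      rw [hh]
      exact_mod_cast h1
    linarith
  have hexp : Real.exp (-2 * γ ^ 2 * u) ≤ Real.exp (-γ ^ 2 * u / 3) := by
    refine Real.exp_le_exp.2 ?_
    have : 0 ≤ γ ^ 2 * u := by positivity
    linarith
  let low : ℕ → Set Ω := fun i =>
    {ω | (maxRank n a (empQuantile u a m i fun t => J t ω) : ℝ) < i * h - μ * h}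
  let high : ℕ → Set Ω := fun i =>
    {ω | i * h + μ * h < (minRank n a (empQuantile u a m i fun t => J t ω) : ℝ)}
  have hlow : ∀ i ∈ Finset.Icc 1 m, μm.real (low i) ≤ Real.exp (-γ ^ 2 * u / 3) := by
    intro i hi
    obtain ⟨hi1, him⟩ := Finset.mem_Icc.1 hi
    have hi1' : (1 : ℝ) ≤ i := by exact_mod_cast hi1
    refine (measureReal_maxRank_empQuantile_lt_le hu hn0 hJmeas hJrange hJunif hJindep a hi1 him
      hγ0 ?_).trans hexp
    rw [← sub_mul, ← mul_le_mul_iff_of_pos_right hm0]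
    have : ((i : ℝ) / m - γ) * n * m = (i - μ / 4) * n := by rw [← hγm]; field_simp
    rw [this, mul_assoc]
    refine mul_le_mul (by linarith) hupper (by positivity) (by linarith)
  have hhigh : ∀ i ∈ Finset.Icc 1 m, μm.real (high i) ≤ Real.exp (-γ ^ 2 * u / 3) := by
    intro i hi
    obtain ⟨hi1, him⟩ := Finset.mem_Icc.1 hi
    have him' : (i : ℝ) ≤ m := by exact_mod_cast him
    refine (measureReal_lt_minRank_empQuantile_le hu hn0 hJmeas hJrange hJunif hJindep a hi1 him
      hγ0 ?_).trans hexp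
    rw [← add_mul, ← mul_le_mul_iff_of_pos_right hm0]
    have hl : (((i : ℝ) / m + γ) * n + 1) * m = (i + μ / 4) * n + m := by
      rw [← hγm]; field_simp
    have hr : ((i : ℝ) + μ) * (n - (m - 1)) ≤ (i + μ) * (h * m) :=
      mul_le_mul_of_nonneg_left (by linarith) (by positivity)
    have hcorr : ((i : ℝ) + μ) * (m - 1) ≤ (m + 1) * (m - 1) :=
      mul_le_mul_of_nonneg_right (by linarith) (by linarith)
    nlinarith
  have hcover : {ω | ∃ i ∈ Finset.Icc 1 m,
        Set.Icc ((minRank n a (empQuantile u a m i (fun t => J t ω)) : ℝ))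
            ((maxRank n a (empQuantile u a m i (fun t => J t ω)) : ℝ)) ∩
          Set.Icc ((i : ℝ) * h - μ * h) ((i : ℝ) * h + μ * h) = ∅} ⊆
      ⋃ i ∈ Finset.Icc 1 m, (low i ∪ high i) := by
    rintro ω ⟨i, hi, hempty⟩
    obtain ⟨hi1, him⟩ := Finset.mem_Icc.1 hi
    refine Set.mem_biUnion hi ?_
    obtain ⟨⟨t, ht⟩, -⟩ := empQuantile_spec a (fun t => J t ω) hu hi1 him
    have hrank := minRank_le_maxRank a (hJrange t ω)
    rw [ht] at hrank
    have hrank' := Nat.cast_le (α := ℝ).2 hrank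
    have hh0 : 0 ≤ μ * h := by positivity
    by_contra hnot
    simp only [low, high, Set.mem_union, Set.mem_ofPred_eq, not_or, not_lt] at hnot
    rw [Set.Icc_inter_Icc, Set.Icc_eq_empty_iff] at hempty
    exact hempty (sup_le (le_inf hrank' hnot.2) (le_inf hnot.1 (by linarith)))
  rw [← ofReal_measureReal]
  refine ENNReal.ofReal_le_ofReal ?_
  calc _ ≤ μm.real (⋃ i ∈ Finset.Icc 1 m, (low i ∪ high i)) := measureReal_mono hcover (measure_ne_top _ _)
    _ ≤ ∑ i ∈ Finset.Icc 1 m, μm.real (low i ∪ high i) := measureReal_biUnion_finset_le _ _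
    _ ≤ ∑ _i ∈ Finset.Icc 1 m, 2 * Real.exp (-γ ^ 2 * u / 3) :=
      Finset.sum_le_sum fun i hi =>
        (measureReal_union_le _ _).trans (by linarith [hlow i hi, hhigh i hi])
    _ = 2 * m * Real.exp (-γ ^ 2 * u / 3) := by
      rw [Finset.sum_const, Nat.card_Icc, nsmul_eq_mul, add_tsub_cancel_right]
      ring
    _ ≤ α := huα
end

section
/- Let 0 ≤ a < b ≤ 1, let ε₂ ∈ (0, 1/4), let n be a positive integer, and let X_1, ..., X_n be independent random variables each uniformly distributed on the interval [a, b]. Set δ₁ = a + ε₂·(b − a). Then the probability that #{i : X_i ≥ δ₁} < n/4 or #{i : X_i < δ₁} > 2ε₂·n is at most e^{−(1−ε₂)n/32} + (e/4)^{ε₂·n}. -/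
open MeasureTheory ProbabilityTheory

/-- The moment generating function at `log 2` of the indicator of an event `A` is `1 + μ A`. -/
lemma mgf_indicator_one_log_two {Ω : Type*} [MeasurableSpace Ω] (μ : Measure Ω)
    [IsProbabilityMeasure μ] {A : Set Ω} (hA : MeasurableSet A) :
    mgf (A.indicator 1) μ (Real.log 2) = 1 + μ.real A := by
  have h : (fun ω => Real.exp (Real.log 2 * A.indicator 1 ω)) =
      fun ω => 1 + A.indicator (1 : Ω → ℝ) ω := by
    funext ω
    by_cases hω : ω ∈ A
    · simp [hω, Real.exp_log]
      norm_num
    · simp [hω]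
  have hint : Integrable (A.indicator (1 : Ω → ℝ)) μ :=
    (integrable_const (1 : ℝ)).indicator hA
  rw [mgf, h, integral_add (integrable_const _) hint, integral_indicator_one hA]
  simp

/-- Multiplicative Chernoff bound: the number of independent random variables falling in a set `S`
is at least twice an upper bound `p * card ι` of its expectation with probability at most
`(e / 4) ^ (p * card ι)`. -/
lemma measureReal_two_mul_le_card_filter_le {Ω ι E : Type*} [MeasurableSpace Ω]
    [MeasurableSpace E] [Fintype ι] (μ : Measure Ω) [IsProbabilityMeasure μ]
    {X : ι → Ω → E} (hmeas : ∀ i, Measurable (X i)) (hindep : iIndepFun X μ)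
    {S : Set E} [DecidablePred (· ∈ S)] (hS : MeasurableSet S) {p : ℝ}
    (hp : ∀ i, μ.real (X i ⁻¹' S) ≤ p) :
    μ.real {ω | 2 * p * Fintype.card ι ≤
        ((Finset.univ.filter (fun i => X i ω ∈ S)).card : ℝ)} ≤
      (Real.exp 1 / 4) ^ (p * Fintype.card ι) := by
  have hind : Measurable (S.indicator (1 : E → ℝ)) := measurable_one.indicator hS
  have hYmeas : ∀ i, Measurable ((X i ⁻¹' S).indicator (1 : Ω → ℝ)) :=
    fun i => measurable_one.indicator (hmeas i hS)
  have hYindep : iIndepFun (fun i => (X i ⁻¹' S).indicator (1 : Ω → ℝ)) μ :=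
    hindep.comp (fun _ => S.indicator (1 : E → ℝ)) fun _ => hind
  have hcard : ∀ ω, ((Finset.univ.filter (fun i => X i ω ∈ S)).card : ℝ) =
      (∑ i, (X i ⁻¹' S).indicator (1 : Ω → ℝ)) ω := by
    intro ω
    classical
    simp [Finset.sum_apply, Set.indicator_apply]
  have hint : Integrable (fun ω => Real.exp
      (Real.log 2 * (∑ i, (X i ⁻¹' S).indicator (1 : Ω → ℝ)) ω)) μ := by
    refine hYindep.integrable_exp_mul_sum hYmeas fun i _ => ?_
    refine integrable_exp_mul_of_mem_Icc (a := 0) (b := 1) (hYmeas i).aemeasurable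
      (Filter.Eventually.of_forall fun ω => ?_)
    by_cases hω : ω ∈ X i ⁻¹' S
    · rw [Set.indicator_of_mem hω]; simp
    · rw [Set.indicator_of_notMem hω]; simp
  have hmgf : mgf (∑ i, (X i ⁻¹' S).indicator (1 : Ω → ℝ)) μ (Real.log 2) ≤
      Real.exp (p * Fintype.card ι) := by
    rw [hYindep.mgf_sum hYmeas, mul_comm, Real.exp_nat_mul, ← Finset.card_univ,
      ← Finset.prod_const]
    refine Finset.prod_le_prod (fun _ _ => mgf_nonneg) fun i _ => ?_
    rw [mgf_indicator_one_log_two μ (hmeas i hS)]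
    linarith [hp i, Real.add_one_le_exp p]
  simp_rw [hcard]
  refine (measure_ge_le_exp_mul_mgf _ (Real.log_nonneg one_le_two) hint).trans ?_
  refine (mul_le_mul_of_nonneg_left hmgf (Real.exp_nonneg _)).trans_eq ?_
  have hlog : Real.log 4 = 2 * Real.log 2 := by
    rw [← Real.log_rpow two_pos]
    norm_num
  rw [Real.rpow_def_of_pos (by positivity), Real.log_div (Real.exp_ne_zero _) (by norm_num),
    Real.log_exp, hlog, ← Real.exp_add]
  congr 1
  ring

/-- A uniform random variable on `[a, b]` lies in the lowest fraction `ε` of the interval with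
probability at most `ε`. -/
lemma measureReal_preimage_Iio_le_of_map_eq_uniform {Ω : Type*} [MeasurableSpace Ω]
    {μ : Measure Ω} {a b ε : ℝ} (hab : a < b) (hε : 0 ≤ ε) {X : Ω → ℝ} (hX : Measurable X)
    (hunif : μ.map X = (ENNReal.ofReal (b - a))⁻¹ • (volume.restrict (Set.Icc a b))) :
    μ.real (X ⁻¹' Set.Iio (a + ε * (b - a))) ≤ ε := by
  have hpos : 0 < b - a := sub_pos.2 hab
  refine ENNReal.toReal_le_of_le_ofReal hε ?_
  rw [← Measure.map_apply hX measurableSet_Iio, hunif, Measure.smul_apply,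
    Measure.restrict_apply measurableSet_Iio, smul_eq_mul]
  have hsub : Set.Iio (a + ε * (b - a)) ∩ Set.Icc a b ⊆ Set.Ico a (a + ε * (b - a)) :=
    fun x hx => ⟨hx.2.1, hx.1⟩
  calc (ENNReal.ofReal (b - a))⁻¹ * volume (Set.Iio (a + ε * (b - a)) ∩ Set.Icc a b)
      ≤ (ENNReal.ofReal (b - a))⁻¹ * volume (Set.Ico a (a + ε * (b - a))) := by gcongr
    _ = ENNReal.ofReal ε := by
      rw [Real.volume_Ico, ← ENNReal.ofReal_inv_of_pos hpos,
        ← ENNReal.ofReal_mul (inv_nonneg.2 hpos.le)]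
      congr 1
      field_simp
      ring

theorem random_items_split
    {Ω : Type*} [MeasurableSpace Ω] (μ : Measure Ω) [IsProbabilityMeasure μ]
    (a b : ℝ) (ha : 0 ≤ a) (hab : a < b) (hb : b ≤ 1)
    (ε₂ : ℝ) (hε₂ : ε₂ ∈ Set.Ioo (0 : ℝ) (1 / 4))
    (n : ℕ) (hn : 0 < n)
    (X : Fin n → Ω → ℝ) (hmeas : ∀ i, Measurable (X i))
    (hindep : iIndepFun X μ)
    (hunif : ∀ i, μ.map (X i) =
      (ENNReal.ofReal (b - a))⁻¹ • (volume.restrict (Set.Icc a b))) :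
    μ {ω | ((Finset.univ.filter (fun i : Fin n => a + ε₂ * (b - a) ≤ X i ω)).card : ℝ) <
          (n : ℝ) / 4 ∨
        2 * ε₂ * n < ((Finset.univ.filter (fun i : Fin n => X i ω < a + ε₂ * (b - a))).card : ℝ)} ≤
      ENNReal.ofReal (Real.exp (-(1 - ε₂) * n / 32) + (Real.exp 1 / 4) ^ (ε₂ * (n : ℝ))) := by
  obtain ⟨hε0, hε4⟩ := hε₂
  have hchernoff := measureReal_two_mul_le_card_filter_le μ hmeas hindep
    (measurableSet_Iio (a := a + ε₂ * (b - a)))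
    fun i => measureReal_preimage_Iio_le_of_map_eq_uniform hab hε0.le (hmeas i) (hunif i)
  simp only [Fintype.card_fin, Set.mem_Iio] at hchernoff
  -- Since `2 * ε₂ ≤ 3 / 4`, having few large items forces having many small ones.
  refine (measure_mono (t := {ω | 2 * ε₂ * n ≤
    ((Finset.univ.filter (fun i : Fin n => X i ω < a + ε₂ * (b - a))).card : ℝ)}) ?_).trans ?_
  · rintro ω (h | h)
    · have hsum : ((Finset.univ.filter (fun i : Fin n => X i ω < a + ε₂ * (b - a))).card : ℝ) +
          (Finset.univ.filter (fun i : Fin n => a + ε₂ * (b - a) ≤ X i ω)).card = n := by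
        have := Finset.card_filter_add_card_filter_not (s := (Finset.univ : Finset (Fin n)))
          (fun i => X i ω < a + ε₂ * (b - a))
        simp only [not_lt, Finset.card_univ, Fintype.card_fin] at this
        exact_mod_cast this
      have hle : ε₂ * n ≤ 1 / 4 * n := by gcongr
      have hn0 : (0 : ℝ) ≤ n := n.cast_nonneg
      change 2 * ε₂ * n ≤ _
      linarith
    · exact h.le
  · rw [← ofReal_measureReal]
    exact ENNReal.ofReal_le_ofReal
      (hchernoff.trans (le_add_of_nonneg_left (Real.exp_nonneg _)))
end
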